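/- On the polynomial ring ℚ[x₁,x₂,x₃,x₄], the derivations R₁ = (1/6)(x₁² − x₂²)·∂/∂x₁ + (1/3)(x₁x₂ − x₂² + 54x₃)·∂/∂x₂ + ((2/3)x₁x₃ + (1/3)x₂x₃ + 9x₄)·∂/∂x₃ + (x₁x₄ + x₃²)·∂/∂x₄, H = 2x₁·∂/∂x₁ + 2x₂·∂/∂x₂ + 4x₃·∂/∂x₃ + 6x₄·∂/∂x₄, and F = −6·∂/∂x₁ satisfy the sl₂ commutation relations ⁅R₁, F⁆ = H, ⁅H, R₁⁆ = 2R₁, and ⁅H, F⁆ = −2F; hence the Lie algebra they generate is isomorphic to sl₂(ℚ). -/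

import Mathlib

open MvPolynomial

/-- The Ramanujan-type vector field `R₁` for `Γ₀(3)`, as a derivation of `ℚ[x₁,x₂,x₃,x₄]`. -/
noncomputable def R1 : Derivation ℚ (MvPolynomial (Fin 4) ℚ) (MvPolynomial (Fin 4) ℚ) :=
  MvPolynomial.mkDerivation ℚ
    ![C (1/6 : ℚ) * (X 0 ^ 2 - X 1 ^ 2),
      C (1/3 : ℚ) * (X 0 * X 1 - X 1 ^ 2 + C 54 * X 2),
      C (2/3 : ℚ) * (X 0 * X 2) + C (1/3 : ℚ) * (X 1 * X 2) + C 9 * X 3,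
      X 0 * X 3 + X 2 ^ 2]

/-- The weight (Euler-type) vector field `H = 2x₁∂₁ + 2x₂∂₂ + 4x₃∂₃ + 6x₄∂₄`. -/
noncomputable def H1 : Derivation ℚ (MvPolynomial (Fin 4) ℚ) (MvPolynomial (Fin 4) ℚ) :=
  MvPolynomial.mkDerivation ℚ ![2 * X 0, 2 * X 1, 4 * X 2, 6 * X 3]

/-- The vector field `F = -6∂₁`. -/
noncomputable def F1 : Derivation ℚ (MvPolynomial (Fin 4) ℚ) (MvPolynomial (Fin 4) ℚ) :=
  MvPolynomial.mkDerivation ℚ ![-6, 0, 0, 0]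

theorem der_two (D : Derivation ℚ (MvPolynomial (Fin 4) ℚ) (MvPolynomial (Fin 4) ℚ)) :
    D 2 = 0 := by
  exact_mod_cast D.map_natCast 2

theorem der_four (D : Derivation ℚ (MvPolynomial (Fin 4) ℚ) (MvPolynomial (Fin 4) ℚ)) :
    D 4 = 0 := by
  exact_mod_cast D.map_natCast 4

theorem der_six (D : Derivation ℚ (MvPolynomial (Fin 4) ℚ) (MvPolynomial (Fin 4) ℚ)) :
    D 6 = 0 := by
  exact_mod_cast D.map_natCast 6

theorem generic_lie {L : Type*} [LieRing L] [LieAlgebra ℚ L] (e h f : L) (hef : ⁅e, f⁆ = h)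
    (hhe : ⁅h, e⁆ = (2 : ℚ) • e) (hhf : ⁅h, f⁆ = (-2 : ℚ) • f) (a b c a' b' c' : ℚ) :
    ⁅a • e + b • h + c • f, a' • e + b' • h + c' • f⁆ =
      (2 * (b * a' - a * b')) • e + (a * c' - c * a') • h + (2 * (c * b' - b * c')) • f := by
  have h1 : ⁅f, e⁆ = -h := by rw [← lie_skew, hef]
  have h2 : ⁅e, h⁆ = -((2 : ℚ) • e) := by rw [← lie_skew, hhe]
  have h3 : ⁅f, h⁆ = -((-2 : ℚ) • f) := by rw [← lie_skew, hhf]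
  simp only [lie_add, add_lie, lie_smul, smul_lie, lie_self, h1, h2, h3, hef, hhe, hhf]
  module

theorem bracket_R1_F1 : ⁅R1, F1⁆ = H1 := by
  apply MvPolynomial.derivation_ext
  intro i
  fin_cases i <;>
    simp [Derivation.commutator_apply, R1, F1, H1, mkDerivation_X, Derivation.leibniz,
      Derivation.leibniz_pow, smul_eq_mul, MvPolynomial.C_mul', der_two,
      der_four, der_six] <;>
    (try simp only [MvPolynomial.smul_eq_C_mul]) <;>
    apply MvPolynomial.funext <;> intro v <;> simp <;> ring

theorem bracket_H1_R1 : ⁅H1, R1⁆ = (2 : ℚ) • R1 := by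
  apply MvPolynomial.derivation_ext
  intro i
  fin_cases i <;>
    simp [Derivation.commutator_apply, R1, F1, H1, mkDerivation_X, Derivation.leibniz,
      Derivation.leibniz_pow, smul_eq_mul, MvPolynomial.C_mul', der_two,
      der_four, der_six] <;>
    (try simp only [MvPolynomial.smul_eq_C_mul]) <;>
    apply MvPolynomial.funext <;> intro v <;> simp <;> ring

theorem bracket_H1_F1 : ⁅H1, F1⁆ = (-2 : ℚ) • F1 := by
  apply MvPolynomial.derivation_ext
  intro i
  fin_cases i <;>
    simp [Derivation.commutator_apply, R1, F1, H1, mkDerivation_X, Derivation.leibniz,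
      Derivation.leibniz_pow, smul_eq_mul, MvPolynomial.C_mul', der_two,
      der_four, der_six] <;>
    (try simp only [MvPolynomial.smul_eq_C_mul]) <;>
    apply MvPolynomial.funext <;> intro v <;> simp <;> ring

/-- The linear map from `sl₂` sending the standard triple to `R1`, `H1`, `F1`. -/
noncomputable def slLin : LieAlgebra.SpecialLinear.sl (Fin 2) ℚ →ₗ[ℚ]
    Derivation ℚ (MvPolynomial (Fin 4) ℚ) (MvPolynomial (Fin 4) ℚ) where
  toFun A := A.1 0 1 • R1 + A.1 0 0 • H1 + A.1 1 0 • F1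
  map_add' A B := by
    change (A.1 0 1 + B.1 0 1) • R1 + (A.1 0 0 + B.1 0 0) • H1 + (A.1 1 0 + B.1 1 0) • F1 = _
    module
  map_smul' c A := by
    change (c * A.1 0 1) • R1 + (c * A.1 0 0) • H1 + (c * A.1 1 0) • F1 =
      c • (A.1 0 1 • R1 + A.1 0 0 • H1 + A.1 1 0 • F1)
    module

theorem mem_sl_iff (A : Matrix (Fin 2) (Fin 2) ℚ) :
    A ∈ LieAlgebra.SpecialLinear.sl (Fin 2) ℚ ↔ A.trace = 0 := Iff.rfl

theorem sl_trace (A : LieAlgebra.SpecialLinear.sl (Fin 2) ℚ) : A.1 1 1 = - A.1 0 0 := by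
  have h := (mem_sl_iff A.1).1 A.2
  rw [Matrix.trace_fin_two] at h
  linarith

/-- `slLin` as a morphism of Lie algebras. -/
noncomputable def slHom : LieAlgebra.SpecialLinear.sl (Fin 2) ℚ →ₗ⁅ℚ⁆
    Derivation ℚ (MvPolynomial (Fin 4) ℚ) (MvPolynomial (Fin 4) ℚ) :=
  { slLin with
    map_lie' := by
      intro A B
      have hA := sl_trace A
      have hB := sl_trace B
      change (⁅A, B⁆ : LieAlgebra.SpecialLinear.sl (Fin 2) ℚ).1 0 1 • R1 +
          (⁅A, B⁆ : LieAlgebra.SpecialLinear.sl (Fin 2) ℚ).1 0 0 • H1 +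
          (⁅A, B⁆ : LieAlgebra.SpecialLinear.sl (Fin 2) ℚ).1 1 0 • F1 =
        ⁅A.1 0 1 • R1 + A.1 0 0 • H1 + A.1 1 0 • F1, B.1 0 1 • R1 + B.1 0 0 • H1 + B.1 1 0 • F1⁆
      refine Eq.trans ?_
        (generic_lie R1 H1 F1 bracket_R1_F1 bracket_H1_R1 bracket_H1_F1 _ _ _ _ _ _).symm
      simp only [LieSubalgebra.coe_bracket, Ring.lie_def, Matrix.sub_apply,
        Matrix.mul_apply, Fin.sum_univ_two, hA, hB]
      module }

theorem slHom_apply (A : LieAlgebra.SpecialLinear.sl (Fin 2) ℚ) :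
    slHom A = A.1 0 1 • R1 + A.1 0 0 • H1 + A.1 1 0 • F1 := rfl

theorem slHom_injective : Function.Injective slHom := by
  rw [injective_iff_map_eq_zero]
  intro A h
  rw [slHom_apply] at h
  have e0 := congrArg (fun D => D (X 0)) h
  have e3 := congrArg (fun D => D (X 3)) h
  simp [R1, H1, F1, mkDerivation_X] at e0 e3
  have a1 := congrArg (MvPolynomial.eval ![0, 0, 0, 0]) e0
  have a2 := congrArg (MvPolynomial.eval ![0, 0, 1, 0]) e3
  have a3 := congrArg (MvPolynomial.eval ![0, 0, 0, 1]) e3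
  simp [MvPolynomial.smul_eval] at a1 a2 a3
  have hA := sl_trace A
  ext i j
  fin_cases i <;> fin_cases j <;> simp_all

theorem slHom_range : slHom.range = LieSubalgebra.lieSpan ℚ
    (Derivation ℚ (MvPolynomial (Fin 4) ℚ) (MvPolynomial (Fin 4) ℚ)) {R1, H1, F1} := by
  apply le_antisymm
  · rintro _ ⟨A, rfl⟩
    change slHom A ∈ _
    rw [slHom_apply]
    refine add_mem (add_mem ?_ ?_) ?_ <;>
      exact LieSubalgebra.smul_mem _ _ (LieSubalgebra.subset_lieSpan (by simp))
  · rw [LieSubalgebra.lieSpan_le]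
    rintro D (rfl | rfl | rfl)
    · refine ⟨⟨!![0, 1; 0, 0], ?_⟩, ?_⟩
      · simp [mem_sl_iff, Matrix.trace_fin_two]
      · exact (slHom_apply _).trans (by simp)
    · refine ⟨⟨!![1, 0; 0, -1], ?_⟩, ?_⟩
      · simp [mem_sl_iff, Matrix.trace_fin_two]
      · exact (slHom_apply _).trans (by simp)
    · refine ⟨⟨!![0, 0; 1, 0], ?_⟩, ?_⟩
      · simp [mem_sl_iff, Matrix.trace_fin_two]
      · exact (slHom_apply _).trans (by simp)

theorem sl2_structure_Gamma0_3 :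
    ⁅R1, F1⁆ = H1 ∧ ⁅H1, R1⁆ = (2 : ℚ) • R1 ∧ ⁅H1, F1⁆ = (-2 : ℚ) • F1 ∧
    Nonempty
      ((LieSubalgebra.lieSpan ℚ
          (Derivation ℚ (MvPolynomial (Fin 4) ℚ) (MvPolynomial (Fin 4) ℚ)) {R1, H1, F1}) ≃ₗ⁅ℚ⁆
        LieAlgebra.SpecialLinear.sl (Fin 2) ℚ) := by
  refine ⟨bracket_R1_F1, bracket_H1_R1, bracket_H1_F1, ?_⟩
  rw [← slHom_range]
  exact ⟨(LieEquiv.ofInjective slHom slHom_injective).symm⟩
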